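/- arXiv:2504.01272 — 6 statements merged into one kernel-verified Lean document; each statement's English description precedes it below -/
import Mathlib

section
/- Let d and m be positive integers, let J be the 2m×2m standard symplectic matrix, and let Z : ℝ → Matrix(d × 2m, ℝ) and S : ℝ → Matrix(2m × 2m, ℝ) be functions such that S(t) is symmetric for every t, and such that Z is differentiable with derivative Z'(t) = -Z(t)·P(t), where P(t) := J·S(t). Then the matrix curve K(t) := J·Z(t)ᵀ·Z(t) is differentiable and satisfies the Lax-pair equation K'(t) = P(t)·K(t) - K(t)·P(t). -/
open Matrix

noncomputable section

/-- The standard symplectic matrix `J = fromBlocks 0 I (-I) 0` on `ℝ^(2m)`,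
indexed by `Fin m ⊕ Fin m`. -/
def sympJ (m : ℕ) : Matrix (Fin m ⊕ Fin m) (Fin m ⊕ Fin m) ℝ :=
  Matrix.fromBlocks 0 1 (-1) 0

theorem sympJ_transpose (m : ℕ) : (sympJ m)ᵀ = -sympJ m := by
  simp [sympJ, Matrix.fromBlocks_transpose, Matrix.fromBlocks_neg]

theorem Matrix.hasDerivAt_mul_apply {l n p : Type*} [Fintype n]
    {A : ℝ → Matrix l n ℝ} {B : ℝ → Matrix n p ℝ} {A' : Matrix l n ℝ} {B' : Matrix n p ℝ} {t : ℝ}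
    (hA : ∀ i j, HasDerivAt (fun s => A s i j) (A' i j) t)
    (hB : ∀ i j, HasDerivAt (fun s => B s i j) (B' i j) t) (i : l) (j : p) :
    HasDerivAt (fun s => (A s * B s) i j) ((A' * B t + A t * B') i j) t := by
  simp only [Matrix.add_apply, Matrix.mul_apply, ← Finset.sum_add_distrib]
  exact HasDerivAt.fun_sum fun k _ => (hA i k).mul (hB k j)

/-- If `Z' = -Z·P` with `P = J·S`, `S` symmetric, then `K = J·Zᵀ·Z` satisfies
the Lax pair equation `K' = P·K - K·P`. -/
theorem lax_pair_for_gram (d m : ℕ) (hd : 0 < d) (hm : 0 < m)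
    (Z : ℝ → Matrix (Fin d) (Fin m ⊕ Fin m) ℝ)
    (S : ℝ → Matrix (Fin m ⊕ Fin m) (Fin m ⊕ Fin m) ℝ)
    (hS : ∀ t, (S t).IsSymm)
    (P : ℝ → Matrix (Fin m ⊕ Fin m) (Fin m ⊕ Fin m) ℝ)
    (hP : ∀ t, P t = sympJ m * S t)
    (hZ : ∀ t i j, HasDerivAt (fun s => Z s i j) ((-(Z t * P t)) i j) t)
    (K : ℝ → Matrix (Fin m ⊕ Fin m) (Fin m ⊕ Fin m) ℝ)
    (hK : ∀ t, K t = sympJ m * (Z t)ᵀ * Z t) :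
    ∀ t i j, HasDerivAt (fun s => K s i j) ((P t * K t - K t * P t) i j) t := by
  intro t
  have hJZ : ∀ i j, HasDerivAt (fun s => (sympJ m * (Z s)ᵀ) i j)
      ((sympJ m * (-(Z t * P t))ᵀ) i j) t := by
    intro i j
    have h := Matrix.hasDerivAt_mul_apply (A := fun _ => sympJ m) (A' := 0)
      (B := fun s => (Z s)ᵀ) (B' := (-(Z t * P t))ᵀ)
      (fun i j => hasDerivAt_const t (sympJ m i j)) (fun i j => hZ t j i) i j
    rwa [Matrix.zero_mul, zero_add] at h
  have hK' : P t * K t - K t * P t =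
      sympJ m * (-(Z t * P t))ᵀ * Z t + sympJ m * (Z t)ᵀ * -(Z t * P t) := by
    simp only [hK, hP, Matrix.transpose_neg, Matrix.transpose_mul, (hS t).eq, sympJ_transpose,
      Matrix.mul_neg, Matrix.neg_mul, neg_neg, Matrix.mul_assoc, sub_eq_add_neg]
  intro i j
  rw [hK']
  simp only [hK]
  exact Matrix.hasDerivAt_mul_apply hJZ (hZ t) i j
end
end

section
/- (Symplectic normal form for positive semidefinite matrices.) Let G be a positive semidefinite real 2m×2m matrix. Then there exist integers p, q ≥ 0 with p + q ≤ m, positive reals ω₁, …, ω_p, and a matrix T ∈ Sp(2m,ℝ), such that Tᵀ·G·T = N(p,q,ω). -/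
open Matrix

noncomputable section

/-- The normal form `N(p,q,ω)`: the `2m×2m` diagonal matrix with `j`-th and `(m+j)`-th
diagonal entries `ω_j²` for `j < p`, `(m+j)`-th diagonal entry `1` for `p ≤ j < p+q`,
and all other entries `0`. -/
def NMat (m p q : ℕ) (ω : Fin p → ℝ) :
    Matrix (Fin m ⊕ Fin m) (Fin m ⊕ Fin m) ℝ :=
  Matrix.diagonal fun i => match i with
    | Sum.inl j => if h : (j : ℕ) < p then (ω ⟨j, h⟩) ^ 2 else 0
    | Sum.inr j => if h : (j : ℕ) < p then (ω ⟨j, h⟩) ^ 2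
        else if (j : ℕ) < p + q then 1 else 0

/-- The pairs of diagonal entries `(a, b)` that a single plane contributes to the normal form. -/
def IsNormalPair (a b : ℝ) : Prop :=
  (0 < a ∧ b = a) ∨ (a = 0 ∧ b = 1) ∨ (a = 0 ∧ b = 0)

section Bilinear

variable {V : Type*} [AddCommGroup V] [Module ℝ V]

/-- `e, f` span a hyperbolic plane of `ω` on which `g` is diagonal with entries `a, b`, and the
`ω`-orthogonal complement of that plane is also `g`-orthogonal to it. -/
structure IsNormalPlane (ω g : LinearMap.BilinForm ℝ V) (e f : V) (a b : ℝ) : Prop where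
  normal : IsNormalPair a b
  pairing : ω e f = 1
  left : g e e = a
  right : g f f = b
  cross : g e f = 0
  compl : ∀ w, ω w e = 0 → ω w f = 0 → g e w = 0 ∧ g f w = 0

/-- A symmetric positive semidefinite bilinear form vanishes on `x` only if `x` is in its kernel. -/
theorem LinearMap.BilinForm.apply_eq_zero_of_apply_self_eq_zero {g : LinearMap.BilinForm ℝ V}
    (hsymm : ∀ x y, g x y = g y x) (hnonneg : ∀ x, 0 ≤ g x x) {x : V} (hx : g x x = 0) (y : V) :
    g x y = 0 := by
  by_contra hne
  have h := hnonneg (y - ((g y y + 1) / (2 * g x y)) • x)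
  simp only [map_sub, map_smul, LinearMap.sub_apply, LinearMap.smul_apply, smul_eq_mul, hx,
    hsymm y x] at h
  have h2 : (g y y + 1) / (2 * g x y) * g x y = (g y y + 1) / 2 := by field_simp
  linarith

variable [FiniteDimensional ℝ V]

/-- An endomorphism symmetric for a positive definite form has an eigenvector. -/
theorem LinearMap.BilinForm.exists_eigenvector_of_symmetric [Nontrivial V]
    {g : LinearMap.BilinForm ℝ V} (hsymm : ∀ x y, g x y = g y x)
    (hpos : ∀ x, x ≠ 0 → 0 < g x x) (B : V →ₗ[ℝ] V) (hB : ∀ x y, g (B x) y = g x (B y)) :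
    ∃ (μ : ℝ) (x : V), x ≠ 0 ∧ B x = μ • x := by
  let c : InnerProductSpace.Core ℝ V :=
    { inner := fun x y => g x y
      conj_inner_symm := fun x y => by simp [hsymm x y]
      re_inner_nonneg := fun x => by
        by_cases h : x = 0
        · simp [h]
        · simpa using (hpos x h).le
      add_left := fun x y z => by simp
      smul_left := fun x y r => by simp
      definite := fun x h => by
        by_contra hx
        exact (hpos x hx).ne' h }
  let : NormedAddCommGroup V := c.toNormedAddCommGroup
  let : InnerProductSpace ℝ V := InnerProductSpace.ofCore c.toCore
  have hS : B.IsSymmetric := fun x y => hB x y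
  obtain ⟨x, hx⟩ := hS.hasEigenvalue_iSup_of_finiteDimensional.exists_hasEigenvector
  exact ⟨_, x, hx.2, hx.apply_eq_smul⟩

/-- A nonzero kernel of `g` yields a normal plane. -/
theorem exists_isNormalPlane_of_mem_ker {ω g : LinearMap.BilinForm ℝ V}
    (halt : ∀ x, ω x x = 0) (hnd : ∀ x, (∀ y, ω x y = 0) → x = 0)
    (hsymm : ∀ x y, g x y = g y x) (hnonneg : ∀ x, 0 ≤ g x x)
    {e : V} (he : e ≠ 0) (hge : g e = 0) :
    ∃ e f a b, IsNormalPlane ω g e f a b := by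
  have hneg : ∀ x y, ω x y = -ω y x := fun x y => (LinearMap.IsAlt.neg halt y x).symm
  by_cases hiso : ∃ f, g f = 0 ∧ ω e f ≠ 0
  · obtain ⟨f, hgf, hef⟩ := hiso
    refine ⟨e, (ω e f)⁻¹ • f, 0, 0, Or.inr (Or.inr ⟨rfl, rfl⟩), ?_, ?_, ?_, ?_, ?_⟩ <;>
      simp [hge, hgf, hef]
  · push Not at hiso
    have hrange : LinearMap.range g = (LinearMap.ker g).dualAnnihilator := by
      apply Submodule.eq_of_le_of_finrank_eq
      · rintro _ ⟨x, rfl⟩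
        rw [Submodule.mem_dualAnnihilator]
        intro y hy
        rw [hsymm, LinearMap.mem_ker.1 hy, LinearMap.zero_apply]
      · have h1 := LinearMap.finrank_range_add_finrank_ker g
        have h2 := Subspace.finrank_add_finrank_dualAnnihilator_eq (LinearMap.ker g)
        exact (Nat.add_left_cancel (h2.trans (h1.symm.trans (add_comm _ _)))).symm
    have hmem : ω e ∈ LinearMap.range g := by
      rw [hrange, Submodule.mem_dualAnnihilator]
      exact fun f hf => hiso f hf
    obtain ⟨f, hf⟩ := hmem
    have hff : 0 < g f f := by
      refine lt_of_le_of_ne (hnonneg f) fun h => he (hnd e fun y => ?_)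
      rw [← hf]
      exact LinearMap.BilinForm.apply_eq_zero_of_apply_self_eq_zero hsymm hnonneg h.symm y
    have hc : 0 < √(g f f) := Real.sqrt_pos.2 hff
    have hcc : √(g f f) * √(g f f) = g f f := Real.mul_self_sqrt hff.le
    have hef : ω e f = g f f := by rw [hf]
    set c := √(g f f)
    have hone : c⁻¹ * (c⁻¹ * g f f) = 1 := by
      rw [← hcc]
      field_simp
    refine ⟨c⁻¹ • e, c⁻¹ • f, 0, 1, Or.inr (Or.inl ⟨rfl, rfl⟩), ?_, ?_, ?_, ?_, fun w hwe _ => ?_⟩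
    · simpa [hef] using hone
    · simp [hge]
    · simpa using hone
    · simp [hge]
    · have hwe : ω e w = 0 := by
        rw [hneg]
        simpa [hc.ne'] using hwe
      simp [hge, hf, hwe]

/-- A positive definite form admits a normal plane. -/
theorem exists_isNormalPlane_of_posDef [Nontrivial V] {ω g : LinearMap.BilinForm ℝ V}
    (halt : ∀ x, ω x x = 0) (hnd : ∀ x, (∀ y, ω x y = 0) → x = 0)
    (hsymm : ∀ x y, g x y = g y x) (hpos : ∀ x, x ≠ 0 → 0 < g x x) :
    ∃ e f a b, IsNormalPlane ω g e f a b := by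
  have hneg : ∀ x y, ω x y = -ω y x := fun x y => (LinearMap.IsAlt.neg halt y x).symm
  have hinj : Function.Injective ω := (injective_iff_map_eq_zero ω).2 fun x hx =>
    hnd x fun y => by rw [hx, LinearMap.zero_apply]
  let Ω : V ≃ₗ[ℝ] Module.Dual ℝ V :=
    LinearEquiv.ofInjectiveOfFinrankEq ω hinj Subspace.dual_finrank_eq.symm
  let A : V →ₗ[ℝ] V := Ω.symm.toLinearMap ∘ₗ g
  have hA : ∀ x y, ω (A x) y = g x y := fun x y => by
    have h : Ω (A x) = g x := by simp [A]
    exact congrArg (fun φ => φ y) h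
  have hskew : ∀ x y, g (A x) y = -g x (A y) := fun x y => by
    rw [hsymm, ← hA y, hneg, hA]
  obtain ⟨μ, x, hx, hμ⟩ := LinearMap.BilinForm.exists_eigenvector_of_symmetric hsymm hpos (A ∘ₗ A)
    fun x y => by simp [hskew]
  replace hμ : A (A x) = μ • x := hμ
  have hN := hpos x hx
  have hAx : A x ≠ 0 := fun h => by
    have h1 := hA x x
    rw [h, map_zero, LinearMap.zero_apply] at h1
    exact hN.ne h1
  have hM := hpos _ hAx
  have hMN : g (A x) (A x) = -μ * g x x := by
    rw [hskew, hμ, map_smul, smul_eq_mul]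
    ring
  have hμ0 : 0 < -μ := by
    rw [hMN] at hM
    exact pos_of_mul_pos_left hM hN.le
  have hκ : 0 < √(-μ) := Real.sqrt_pos.2 hμ0
  have hκκ : √(-μ) * √(-μ) = -μ := Real.mul_self_sqrt hμ0.le
  set κ := √(-μ)
  have ht : 0 < (√(κ * g x x))⁻¹ := by positivity
  have htt : (√(κ * g x x))⁻¹ * (√(κ * g x x))⁻¹ * (κ * g x x) = 1 := by
    rw [← mul_inv, Real.mul_self_sqrt (by positivity)]
    exact inv_mul_cancel₀ (by positivity)
  set t := (√(κ * g x x))⁻¹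
  have hxA : ω x (A x) = -g x x := by rw [hneg, hA]
  have hgxA : g x (A x) = 0 := by rw [← hA, halt]
  refine ⟨(-(κ * t)) • x, t • A x, κ, κ, Or.inl ⟨hκ, rfl⟩, ?_, ?_, ?_, ?_, fun w hwe hwf => ?_⟩
  · simp only [map_smul, LinearMap.smul_apply, smul_eq_mul, hxA]
    linarith
  · simp only [map_smul, LinearMap.smul_apply, smul_eq_mul]
    linear_combination κ * htt
  · simp only [map_smul, LinearMap.smul_apply, smul_eq_mul, hMN, ← hκκ]
    linear_combination κ * htt
  · simp [hgxA]
  · have hwx : ω w x = 0 := by simpa [hκ.ne', ht.ne'] using hwe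
    have hwA : ω w (A x) = 0 := by simpa [ht.ne'] using hwf
    constructor
    · rw [map_smul, LinearMap.smul_apply, ← hA, hneg, hwA]
      simp
    · rw [map_smul, LinearMap.smul_apply, ← hA, hμ, hneg, map_smul, hwx]
      simp

/-- A nontrivial symplectic space with a positive semidefinite form admits a normal plane. -/
theorem exists_isNormalPlane [Nontrivial V] {ω g : LinearMap.BilinForm ℝ V}
    (halt : ∀ x, ω x x = 0) (hnd : ∀ x, (∀ y, ω x y = 0) → x = 0)
    (hsymm : ∀ x y, g x y = g y x) (hnonneg : ∀ x, 0 ≤ g x x) :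
    ∃ e f a b, IsNormalPlane ω g e f a b := by
  by_cases h : ∃ x, x ≠ 0 ∧ g x x = 0
  · obtain ⟨x, hx, hgx⟩ := h
    exact exists_isNormalPlane_of_mem_ker halt hnd hsymm hnonneg hx <| LinearMap.ext
      (LinearMap.BilinForm.apply_eq_zero_of_apply_self_eq_zero hsymm hnonneg hgx)
  · push Not at h
    exact exists_isNormalPlane_of_posDef halt hnd hsymm fun x hx =>
      (hnonneg x).lt_of_ne' (h x hx)

end Bilinear

/-- A symplectic basis of `V` diagonalizing a positive semidefinite form. -/
theorem exists_symplectic_basis_diagonalizing (n : ℕ) :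
    ∀ {V : Type} [AddCommGroup V] [Module ℝ V] [FiniteDimensional ℝ V]
      {ω g : LinearMap.BilinForm ℝ V}, Module.finrank ℝ V = n →
      (∀ x, ω x x = 0) → (∀ x, (∀ y, ω x y = 0) → x = 0) →
      (∀ x y, g x y = g y x) → (∀ x, 0 ≤ g x x) →
      ∃ (k : ℕ) (e f : Fin k → V) (a b : Fin k → ℝ), n = 2 * k ∧
        (∀ i, IsNormalPair (a i) (b i)) ∧
        (∀ i j, ω (e i) (e j) = 0) ∧ (∀ i j, ω (f i) (f j) = 0) ∧
        (∀ i j, ω (e i) (f j) = if i = j then 1 else 0) ∧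
        (∀ i j, g (e i) (e j) = if i = j then a i else 0) ∧
        (∀ i j, g (f i) (f j) = if i = j then b i else 0) ∧
        (∀ i j, g (e i) (f j) = 0) := by
  induction n using Nat.strong_induction_on with
  | _ n ih =>
    intro V _ _ _ ω g hn halt hnd hsymm hnonneg
    rcases Nat.eq_zero_or_pos n with rfl | hpos
    · exact ⟨0, Fin.elim0, Fin.elim0, Fin.elim0, Fin.elim0, rfl, fun i => i.elim0,
        fun i => i.elim0, fun i => i.elim0, fun i => i.elim0, fun i => i.elim0,
        fun i => i.elim0, fun i => i.elim0⟩
    have : Nontrivial V := Module.nontrivial_of_finrank_pos (R := ℝ) (hn ▸ hpos)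
    have hneg : ∀ x y, ω x y = -ω y x := fun x y => (LinearMap.IsAlt.neg halt y x).symm
    obtain ⟨e, f, a, b, hp⟩ := exists_isNormalPlane halt hnd hsymm hnonneg
    have hfe : ω f e = -1 := by rw [hneg, hp.pairing]
    let φ : V →ₗ[ℝ] ℝ × ℝ := (ω.flip e).prod (ω.flip f)
    have hφ : ∀ w : LinearMap.ker φ, ω w e = 0 ∧ ω w f = 0 := fun w => by
      simpa [φ] using w.2
    have hsurj : LinearMap.range φ = ⊤ := LinearMap.range_eq_top.2 fun ⟨r, s⟩ =>
      ⟨s • e - r • f, by simp [φ, halt, hfe, hp.pairing]⟩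
    have hdim : Module.finrank ℝ (LinearMap.ker φ) + 2 = n := by
      have h := LinearMap.finrank_range_add_finrank_ker φ
      rw [hsurj, finrank_top, Module.finrank_prod, Module.finrank_self] at h
      omega
    obtain ⟨k, e', f', a', b', hk, hab, hee, hff, hef, gee, gff, gef⟩ :=
      ih _ (by omega) (V := LinearMap.ker φ) (ω := ω.restrict _) (g := g.restrict _) rfl
        (fun x => halt x)
        (fun x hx => by
          refine Subtype.ext (hnd x fun v => ?_)
          have hw : v - ω v f • e + ω v e • f ∈ LinearMap.ker φ := by
            simp [φ, halt, hfe, hp.pairing]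
          have h : ω x (v - ω v f • e + ω v e • f) = 0 := hx ⟨_, hw⟩
          simpa [hφ x] using h)
        (fun x y => hsymm x y) (fun x => hnonneg x)
    have hφ' : ∀ w : LinearMap.ker φ, ω e w = 0 ∧ ω f w = 0 := fun w => by
      rw [hneg e, hneg f, (hφ w).1, (hφ w).2]
      simp
    have hg : ∀ w : LinearMap.ker φ, g e w = 0 ∧ g f w = 0 := fun w =>
      hp.compl w (hφ w).1 (hφ w).2
    have hg' : ∀ w : LinearMap.ker φ, g w e = 0 ∧ g w f = 0 := fun w => by
      rw [hsymm _ e, hsymm _ f]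
      exact hg w
    simp only [LinearMap.BilinForm.restrict_apply, LinearMap.domRestrict_apply]
      at hee hff hef gee gff gef
    refine ⟨k + 1, Fin.cons e fun i => e' i, Fin.cons f fun i => f' i, Fin.cons a a',
      Fin.cons b b', by omega, ?_, ?_, ?_, ?_, ?_, ?_, ?_⟩
    · exact Fin.cases hp.normal hab
    all_goals
      refine Fin.cases (Fin.cases ?_ fun j => ?_) fun i => Fin.cases ?_ fun j => ?_
    all_goals
      simp [halt, hp.pairing, hp.left, hp.right, hp.cross, hφ, hφ', hg, hg', hee, hff, hef, gee, gff,
        gef, Fin.succ_ne_zero, (Fin.succ_ne_zero _).symm]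

/-- The indices satisfying `P` can be moved to the front, followed by the remaining ones that
satisfy `Q`. -/
theorem exists_perm_sorted {m : ℕ} (P Q : Fin m → Prop) :
    ∃ (σ : Equiv.Perm (Fin m)) (p q : ℕ), p + q ≤ m ∧ (∀ j : Fin m, (j : ℕ) < p ↔ P (σ j)) ∧
      ∀ j : Fin m, ¬ (j : ℕ) < p → ((j : ℕ) < p + q ↔ Q (σ j)) := by
  classical
  obtain ⟨key, hkey⟩ : ∃ key : Fin m → ℕ, ∀ i, key i = if P i then 0 else if Q i then 1 else 2 :=
    ⟨_, fun _ => rfl⟩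
  have hmono : Monotone (key ∘ Tuple.sort key) := Tuple.monotone_sort key
  have hlt : ∀ (c : ℕ) (j : Fin m), (j : ℕ) < Fintype.card {i // (key ∘ Tuple.sort key) i ≤ c} ↔
      key (Tuple.sort key j) ≤ c := fun c j => by
    rw [Fintype.card_subtype]
    exact Tuple.lt_card_le_iff_apply_le_of_monotone hmono
  obtain ⟨q, hq⟩ := Nat.exists_eq_add_of_le <|
    Fintype.card_subtype_mono (fun i => (key ∘ Tuple.sort key) i ≤ 0)
      (fun i => (key ∘ Tuple.sort key) i ≤ 1) fun i hi => le_trans hi zero_le_one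
  have hP : ∀ j : Fin m, (j : ℕ) < Fintype.card {i // (key ∘ Tuple.sort key) i ≤ 0} ↔
      P (Tuple.sort key j) := fun j => by
    rw [hlt, hkey]
    split_ifs with h1 h2 <;> simp [h1]
  refine ⟨Tuple.sort key, _, q, ?_, hP, fun j hj => ?_⟩
  · rw [← hq]
    exact (Fintype.card_subtype_le _).trans_eq (Fintype.card_fin m)
  · rw [hP] at hj
    rw [← hq, hlt, hkey, if_neg hj]
    split_ifs with h <;> simp [h]

theorem Matrix.of_mul_mul_transpose_apply_eq_toBilin' {ι κ : Type*} [Fintype ι] [DecidableEq ι]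
    (M : Matrix ι ι ℝ) (t : κ → ι → ℝ) (i j : κ) :
    (Matrix.of t * M * (Matrix.of t)ᵀ) i j = Matrix.toBilin' M (t i) (t j) := by
  rw [Matrix.toBilin'_apply', Matrix.dotProduct_mulVec]
  rfl

/-- Symplectic normal form for positive semidefinite matrices: any positive
semidefinite `G` is symplectically congruent to some `N(p,q,ω)`. -/
theorem posSemidef_symplectic_normal_form (m : ℕ)
    (G : Matrix (Fin m ⊕ Fin m) (Fin m ⊕ Fin m) ℝ) (hG : G.PosSemidef) :
    ∃ (p q : ℕ) (_ : p + q ≤ m) (ω : Fin p → ℝ),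
      (∀ j, 0 < ω j) ∧
      ∃ T : Matrix (Fin m ⊕ Fin m) (Fin m ⊕ Fin m) ℝ,
        Tᵀ * sympJ m * T = sympJ m ∧ Tᵀ * G * T = NMat m p q ω := by
  have hJT : (sympJ m)ᵀ = -sympJ m := by
    simp [sympJ, Matrix.fromBlocks_transpose, Matrix.fromBlocks_neg]
  have hJJ : sympJ m * sympJ m = -1 := by
    simp [sympJ, Matrix.fromBlocks_multiply, ← Matrix.fromBlocks_one, Matrix.fromBlocks_neg]
  have hGT : Gᵀ = G := by simpa using hG.isHermitian.eq
  have hJ : ∀ x, Matrix.toBilin' (sympJ m) x x = 0 := fun x => by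
    have h : Matrix.toBilin' (sympJ m) x x = -Matrix.toBilin' (sympJ m) x x := by
      conv_lhs => rw [Matrix.toBilin'_apply', Matrix.dotProduct_mulVec, ← Matrix.mulVec_transpose,
        hJT, dotProduct_comm, Matrix.neg_mulVec, dotProduct_neg, ← Matrix.toBilin'_apply']
    linarith
  obtain ⟨k, e, f, a, b, hk, hab, hee, hff, hef, gee, gff, gef⟩ :=
    exists_symplectic_basis_diagonalizing (m + m) (V := Fin m ⊕ Fin m → ℝ)
      (ω := Matrix.toBilin' (sympJ m)) (g := Matrix.toBilin' G) (by simp) hJ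
      (fun x hx => by
        have h : x ᵥ* sympJ m = 0 := dotProduct_eq_zero _ fun y => by
          rw [← Matrix.dotProduct_mulVec, ← Matrix.toBilin'_apply', hx]
        have h2 : x ᵥ* (sympJ m * sympJ m) = 0 := by
          rw [← Matrix.vecMul_vecMul, h, Matrix.zero_vecMul]
        simpa [hJJ, Matrix.vecMul_neg] using h2)
      (fun x y => by
        rw [Matrix.toBilin'_apply', Matrix.dotProduct_mulVec, ← Matrix.mulVec_transpose, hGT,
          dotProduct_comm, ← Matrix.toBilin'_apply'])
      (fun x => by simpa [Matrix.toBilin'_apply'] using hG.dotProduct_mulVec_nonneg x)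
  obtain rfl : m = k := by omega
  have hneg : ∀ x y, Matrix.toBilin' (sympJ m) x y = -Matrix.toBilin' (sympJ m) y x :=
    fun x y => (LinearMap.IsAlt.neg hJ y x).symm
  have hgsymm : ∀ x y, Matrix.toBilin' G x y = Matrix.toBilin' G y x := fun x y => by
    rw [Matrix.toBilin'_apply', Matrix.dotProduct_mulVec, ← Matrix.mulVec_transpose, hGT,
      dotProduct_comm, ← Matrix.toBilin'_apply']
  obtain ⟨σ, p, q, hpq, hapos, hbone⟩ := exists_perm_sorted (fun i => 0 < a i) fun i => b i = 1
  refine ⟨p, q, hpq, fun j => √(a (σ ⟨j, by omega⟩)), fun j => ?_,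
    (Matrix.of (Sum.elim (e ∘ σ) (f ∘ σ)))ᵀ, ?_, ?_⟩
  · exact Real.sqrt_pos.2 ((hapos _).1 j.2)
  · ext i j
    rw [Matrix.transpose_transpose, Matrix.of_mul_mul_transpose_apply_eq_toBilin']
    rcases i with i | i <;> rcases j with j | j
    · simp only [Sum.elim_inl, Function.comp_apply, hee]
      simp [sympJ]
    · simp only [Sum.elim_inl, Sum.elim_inr, Function.comp_apply, hef]
      simp [sympJ, Matrix.one_apply]
    · simp only [Sum.elim_inl, Sum.elim_inr, Function.comp_apply, hneg (f _), hef]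
      simp [sympJ, Matrix.one_apply, eq_comm]
    · simp only [Sum.elim_inr, Function.comp_apply, hff]
      simp [sympJ]
  · ext i j
    rw [Matrix.transpose_transpose, Matrix.of_mul_mul_transpose_apply_eq_toBilin', NMat,
      Matrix.diagonal_apply]
    rcases i with i | i <;> rcases j with j | j
    · simp only [Sum.elim_inl, Function.comp_apply, gee, EmbeddingLike.apply_eq_iff_eq,
        Sum.inl.injEq, hapos]
      rcases hab (σ i) with ⟨h1, h2⟩ | ⟨h1, h2⟩ | ⟨h1, h2⟩ <;> simp [h1, Real.sq_sqrt, h1.le]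
    · simp [gef]
    · simp [hgsymm (f _), gef]
    · simp only [Sum.elim_inr, Function.comp_apply, gff, EmbeddingLike.apply_eq_iff_eq,
        Sum.inr.injEq]
      by_cases hi : (i : ℕ) < p
      · have h1 := (hapos i).1 hi
        rcases hab (σ i) with ⟨-, h2⟩ | ⟨h2, -⟩ | ⟨h2, -⟩
        · simp [hi, h2, Real.sq_sqrt, h1.le]
        all_goals exact absurd h2 h1.ne'
      · have h1 := mt (hapos i).2 hi
        simp only [hi, hbone i hi]
        rcases hab (σ i) with ⟨h2, -⟩ | ⟨-, h2⟩ | ⟨-, h2⟩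
        · exact absurd h2 h1
        all_goals simp [h2]
end
end

section
/- Let p, q, p', q' be nonnegative integers with p + q ≤ m and p' + q' ≤ m, and let ω₁ ≥ … ≥ ω_p > 0 and ω'₁ ≥ … ≥ ω'_{p'} > 0. Then there exists T ∈ Sp(2m,ℝ) with Tᵀ·N(p,q,ω)·T = N(p',q',ω') if and only if p = p', q = q', and ω_j = ω'_j for all j. That is, the Sp(2m,ℝ)-congruence orbit of a positive semidefinite matrix is uniquely determined by its numerical invariants (p,q) and its spectral invariants ω_j². -/
open Matrix

noncomputable section

/-- Antitone tuples with the same multiset of values are equal. -/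
theorem Antitone.eq_of_map_univ_val_eq {α : Type*} [PartialOrder α] {n : ℕ} {f g : Fin n → α}
    (hf : Antitone f) (hg : Antitone g)
    (h : Multiset.map f Finset.univ.val = Multiset.map g Finset.univ.val) : f = g := by
  rw [Fin.univ_val_map, Fin.univ_val_map, Multiset.coe_eq_coe] at h
  exact List.ofFn_injective
    (h.eq_of_pairwise' hf.sortedGE_ofFn.pairwise hg.sortedGE_ofFn.pairwise)

/-- Diagonal matrices with the same characteristic polynomial have the same multiset of
diagonal entries. -/
theorem Matrix.map_univ_val_eq_of_charpoly_diagonal_eq {n R : Type*} [Fintype n] [DecidableEq n]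
    [CommRing R] [IsDomain R] {d e : n → R}
    (h : (diagonal d).charpoly = (diagonal e).charpoly) :
    Multiset.map d Finset.univ.val = Multiset.map e Finset.univ.val := by
  have key : ∀ f : n → R,
      (diagonal f).charpoly.roots = Multiset.map f Finset.univ.val := fun f ↦ by
    rw [charpoly_diagonal, Polynomial.roots_prod _ _
      (Finset.prod_ne_zero_iff.mpr fun a _ ↦ Polynomial.X_sub_C_ne_zero _)]
    simp [Polynomial.roots_X_sub_C]
  rw [← key, ← key, h]

theorem sympJ_mul_self (m : ℕ) : sympJ m * sympJ m = -1 := by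
  rw [sympJ, fromBlocks_multiply, ← fromBlocks_one, fromBlocks_neg]
  simp

/-- The left inverse of a symplectic matrix given by its transpose. -/
theorem neg_sympJ_mul_transpose_mul_sympJ_mul {m : ℕ}
    {T : Matrix (Fin m ⊕ Fin m) (Fin m ⊕ Fin m) ℝ} (hT : Tᵀ * sympJ m * T = sympJ m) :
    -(sympJ m * Tᵀ * sympJ m) * T = 1 := by
  calc -(sympJ m * Tᵀ * sympJ m) * T = -(sympJ m * (Tᵀ * sympJ m * T)) := by noncomm_ring
    _ = 1 := by rw [hT, sympJ_mul_self, neg_neg]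

/-- The Hamiltonian square `(J G)²` has a characteristic polynomial that is invariant under
symplectic congruence of `G`. -/
theorem charpoly_sq_sympJ_mul_congr {m : ℕ}
    {T : Matrix (Fin m ⊕ Fin m) (Fin m ⊕ Fin m) ℝ} (hT : Tᵀ * sympJ m * T = sympJ m)
    (G : Matrix (Fin m ⊕ Fin m) (Fin m ⊕ Fin m) ℝ) :
    ((sympJ m * (Tᵀ * G * T)) * (sympJ m * (Tᵀ * G * T))).charpoly =
      ((sympJ m * G) * (sympJ m * G)).charpoly := by
  set L := -(sympJ m * Tᵀ * sympJ m) with hL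
  have hLT : L * T = 1 := neg_sympJ_mul_transpose_mul_sympJ_mul hT
  have hTL : T * L = 1 := mul_eq_one_comm.mp hLT
  have hLJ : sympJ m * Tᵀ = L * sympJ m := by
    rw [hL, neg_mul, mul_assoc _ (sympJ m) (sympJ m), sympJ_mul_self]
    simp
  have hconj : sympJ m * (Tᵀ * G * T) = L * (sympJ m * G) * T := by
    rw [mul_assoc Tᵀ, ← mul_assoc, hLJ]
    simp only [mul_assoc]
  rw [hconj]
  calc (L * (sympJ m * G) * T * (L * (sympJ m * G) * T)).charpoly
      = (L * ((sympJ m * G) * (T * L) * (sympJ m * G) * T)).charpoly := by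
        simp only [mul_assoc]
    _ = _ := by
        rw [charpoly_mul_comm, hTL, mul_one, mul_assoc, hTL, mul_one]

/-- The tuple of fourth powers `ω_j⁴`, padded with zeros to length `m`. -/
def paddedPow (m p : ℕ) (ω : Fin p → ℝ) (j : Fin m) : ℝ :=
  if h : (j : ℕ) < p then (ω ⟨j, h⟩) ^ 4 else 0

theorem antitone_paddedPow (m : ℕ) {p : ℕ} {ω : Fin p → ℝ} (hω : ∀ j, 0 < ω j)
    (hmono : Antitone ω) : Antitone (paddedPow m p ω) := by
  intro i j hij
  have hij' : (i : ℕ) ≤ j := hij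
  unfold paddedPow
  by_cases hj : (j : ℕ) < p
  · rw [dif_pos hj, dif_pos (hij'.trans_lt hj)]
    exact pow_le_pow_left₀ (hω _).le (hmono hij') 4
  · rw [dif_neg hj]
    split_ifs with hi
    · exact (pow_pos (hω _) 4).le
    · exact le_rfl

theorem paddedPow_ne_zero_iff {m p : ℕ} {ω : Fin p → ℝ} (hω : ∀ j, 0 < ω j) (j : Fin m) :
    paddedPow m p ω j ≠ 0 ↔ (j : ℕ) < p := by
  unfold paddedPow
  split_ifs with h
  · simpa [h] using (hω ⟨j, h⟩).ne'
  · simp [h]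

theorem sq_sympJ_mul_NMat (m p q : ℕ) (ω : Fin p → ℝ) :
    (sympJ m * NMat m p q ω) * (sympJ m * NMat m p q ω) =
      diagonal (Sum.elim (fun j ↦ -paddedPow m p ω j) fun j ↦ -paddedPow m p ω j) := by
  have hN : NMat m p q ω = fromBlocks
      (diagonal fun j : Fin m ↦ if h : (j : ℕ) < p then (ω ⟨j, h⟩) ^ 2 else 0) 0 0
      (diagonal fun j : Fin m ↦ if h : (j : ℕ) < p then (ω ⟨j, h⟩) ^ 2
        else if (j : ℕ) < p + q then 1 else 0) := by
    rw [NMat, fromBlocks_diagonal]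
    congr 1
    ext (i | i) <;> rfl
  rw [hN, sympJ, fromBlocks_multiply, fromBlocks_multiply, ← fromBlocks_diagonal]
  simp only [zero_mul, mul_zero, one_mul, neg_mul, mul_neg, zero_add, add_zero, diagonal_mul_diagonal,
    diagonal_neg]
  congr 2 <;>
  · ext j
    unfold paddedPow
    by_cases h : (j : ℕ) < p
    · simp only [h, dite_true]; ring
    · simp [h]

theorem rank_NMat {m p q : ℕ} (hpq : p + q ≤ m) {ω : Fin p → ℝ} (hω : ∀ j, 0 < ω j) :
    (NMat m p q ω).rank = p + (p + q) := by
  have hl : ∀ j : Fin m, (if h : (j : ℕ) < p then (ω ⟨j, h⟩) ^ 2 else 0) ≠ 0 ↔ (j : ℕ) < p := by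
    intro j
    split_ifs with h
    · simpa [h] using (hω ⟨j, h⟩).ne'
    · simp [h]
  have hr : ∀ j : Fin m, (if h : (j : ℕ) < p then (ω ⟨j, h⟩) ^ 2
      else if (j : ℕ) < p + q then 1 else 0) ≠ 0 ↔ (j : ℕ) < p + q := by
    intro j
    split_ifs with h h'
    · simpa [show (j : ℕ) < p + q by omega] using (hω ⟨j, h⟩).ne'
    · simp [h']
    · simp [h']
  rw [NMat, rank_diagonal, Fintype.card_subtype, Finset.card_filter, Fintype.sum_sum_type]
  simp only [hl, hr, ← Finset.card_filter, Fin.card_filter_val_lt]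
  omega

theorem rank_congr_of_symplectic {m : ℕ}
    {T : Matrix (Fin m ⊕ Fin m) (Fin m ⊕ Fin m) ℝ} (hT : Tᵀ * sympJ m * T = sympJ m)
    (G : Matrix (Fin m ⊕ Fin m) (Fin m ⊕ Fin m) ℝ) : (Tᵀ * G * T).rank = G.rank := by
  have hdet : IsUnit T.det :=
    isUnit_det_of_left_inverse (neg_sympJ_mul_transpose_mul_sympJ_mul hT)
  rw [rank_mul_eq_left_of_isUnit_det _ _ hdet,
    rank_mul_eq_right_of_isUnit_det _ _ (by rwa [det_transpose])]

theorem paddedPow_eq_of_symplectic_congr {m p q p' q' : ℕ} {ω : Fin p → ℝ} {ω' : Fin p' → ℝ}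
    (hω : ∀ j, 0 < ω j) (hω' : ∀ j, 0 < ω' j) (hmono : Antitone ω) (hmono' : Antitone ω')
    {T : Matrix (Fin m ⊕ Fin m) (Fin m ⊕ Fin m) ℝ} (hT : Tᵀ * sympJ m * T = sympJ m)
    (hTN : Tᵀ * NMat m p q ω * T = NMat m p' q' ω') :
    paddedPow m p ω = paddedPow m p' ω' := by
  have h := charpoly_sq_sympJ_mul_congr hT (NMat m p q ω)
  rw [hTN, sq_sympJ_mul_NMat, sq_sympJ_mul_NMat] at h
  have hms := congrArg (Multiset.map Neg.neg) (map_univ_val_eq_of_charpoly_diagonal_eq h)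
  have key : ∀ f : Fin m → ℝ, Multiset.map Neg.neg (Multiset.map
      (Sum.elim (fun j ↦ -f j) fun j ↦ -f j) (Finset.univ : Finset (Fin m ⊕ Fin m)).val) =
      2 • Multiset.map f Finset.univ.val := fun f ↦ by
    rw [← Finset.univ_disjSum_univ, Finset.val_disjSum, Multiset.disjSum]
    simp [Function.comp_def, two_nsmul]
  rw [key, key] at hms
  exact (antitone_paddedPow m hω hmono).eq_of_map_univ_val_eq (antitone_paddedPow m hω' hmono')
    (nsmul_right_injective two_ne_zero hms).symm

/-- Two normal forms (with decreasingly ordered positive `ω`'s) are symplectically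
congruent iff their numerical invariants `(p,q)` and spectral invariants agree. -/
theorem normal_form_congruent_iff_invariants_eq (m p q p' q' : ℕ)
    (hpq : p + q ≤ m) (hpq' : p' + q' ≤ m)
    (ω : Fin p → ℝ) (ω' : Fin p' → ℝ)
    (hω : ∀ j, 0 < ω j) (hω' : ∀ j, 0 < ω' j)
    (hmono : Antitone ω) (hmono' : Antitone ω') :
    (∃ T : Matrix (Fin m ⊕ Fin m) (Fin m ⊕ Fin m) ℝ,
        Tᵀ * sympJ m * T = sympJ m ∧ Tᵀ * NMat m p q ω * T = NMat m p' q' ω')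
      ↔ ∃ hp : p = p', q = q' ∧ ∀ j : Fin p, ω j = ω' (Fin.cast hp j) := by
  constructor
  · rintro ⟨T, hT, hTN⟩
    have hpad := paddedPow_eq_of_symplectic_congr hω hω' hmono hmono' hT hTN
    have hlt : ∀ j : Fin m, (j : ℕ) < p ↔ (j : ℕ) < p' := fun j ↦ by
      rw [← paddedPow_ne_zero_iff hω, ← paddedPow_ne_zero_iff hω', hpad]
    have hp : p = p' := by
      rcases lt_trichotomy p p' with h | h | h
      · have := (hlt ⟨p, by omega⟩).mpr h
        simp at this
      · exact h
      · have := (hlt ⟨p', by omega⟩).mp h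
        simp at this
    subst hp
    have hrank := rank_congr_of_symplectic hT (NMat m p q ω)
    rw [hTN, rank_NMat hpq hω, rank_NMat hpq' hω'] at hrank
    refine ⟨rfl, by omega, fun j ↦ ?_⟩
    have hj := congrFun hpad ⟨j, by omega⟩
    simp only [paddedPow, j.isLt, dite_true] at hj
    exact (pow_left_inj₀ (hω j).le (hω' j).le four_ne_zero).mp hj
  · rintro ⟨rfl, rfl, h⟩
    obtain rfl : ω = ω' := funext h
    exact ⟨1, by simp, by simp⟩
end
end

section
/- Let p, q ≥ 0 be integers with p + q ≤ m, let ω₁, …, ω_p > 0, and let 0 ≤ q' ≤ q. Then the matrix N(p,q',ω) lies in the closure of the Sp(2m,ℝ)-congruence orbit of N(p,q,ω): indeed the symplectic scalings T_ε ∈ Sp(2m,ℝ) given by x_j ↦ x_j/ε, y_j ↦ ε·y_j for p < j ≤ p+q (identity on the other coordinates) satisfy T_εᵀ·N(p,q,ω)·T_ε → N(p,q',ω) as the appropriate ε's tend to 0. -/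
open Matrix

noncomputable section

/-- The `Sp(2m,ℝ)`-congruence orbit of a matrix `G`. -/
def sympOrbit (m : ℕ) (G : Matrix (Fin m ⊕ Fin m) (Fin m ⊕ Fin m) ℝ) :
    Set (Matrix (Fin m ⊕ Fin m) (Fin m ⊕ Fin m) ℝ) :=
  {A | ∃ T : Matrix (Fin m ⊕ Fin m) (Fin m ⊕ Fin m) ℝ,
      Tᵀ * sympJ m * T = sympJ m ∧ A = Tᵀ * G * T}

/-- The symplectic scaling `x_j ↦ x_j/ε`, `y_j ↦ ε·y_j` on the coordinates with
`p + q' ≤ j < p + q`, identity on the other coordinates. -/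
def scaleT (m p q q' : ℕ) (ε : ℝ) :
    Matrix (Fin m ⊕ Fin m) (Fin m ⊕ Fin m) ℝ :=
  Matrix.diagonal fun i => match i with
    | Sum.inl j => if p + q' ≤ (j : ℕ) ∧ (j : ℕ) < p + q then ε⁻¹ else 1
    | Sum.inr j => if p + q' ≤ (j : ℕ) ∧ (j : ℕ) < p + q then ε else 1

theorem scaleT_symplectic (m p q q' : ℕ) {ε : ℝ} (hε : ε ≠ 0) :
    (scaleT m p q q' ε)ᵀ * sympJ m * scaleT m p q q' ε = sympJ m := by
  ext i j
  rw [scaleT, diagonal_transpose, mul_diagonal, diagonal_mul]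
  rcases i with i | i <;> rcases j with j | j
  · simp [sympJ]
  · by_cases h : i = j
    · subst h
      simp only [sympJ, fromBlocks_apply₁₂, one_apply_eq]
      split_ifs <;> simp [hε]
    · simp [sympJ, h]
  · by_cases h : i = j
    · subst h
      simp only [sympJ, fromBlocks_apply₂₁]
      split_ifs <;> simp [hε]
    · simp [sympJ, h]
  · simp [sympJ]

theorem scaleT_congr_NMat (m p : ℕ) {q q' : ℕ} (hq' : q' ≤ q) (ω : Fin p → ℝ) (ε : ℝ) :
    (scaleT m p q q' ε)ᵀ * NMat m p q ω * scaleT m p q q' ε =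
      NMat m p q' ω + ε ^ 2 • (NMat m p q ω - NMat m p q' ω) := by
  rw [scaleT, NMat, NMat, diagonal_transpose, diagonal_mul_diagonal, diagonal_mul_diagonal,
    diagonal_sub, ← diagonal_smul, diagonal_add]
  congr 1
  ext i
  rcases i with j | j <;> simp only [Pi.smul_apply, smul_eq_mul] <;> split_ifs <;>
    first | omega | ring

/-- For `q' ≤ q`, the normal form `N(p,q',ω)` lies in the closure of the symplectic
congruence orbit of `N(p,q,ω)`: the symplectic scalings `T_ε` are symplectic for
`ε ≠ 0` and `T_εᵀ·N(p,q,ω)·T_ε → N(p,q',ω)` as `ε → 0`. -/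
theorem normal_form_in_closure_via_scaling (m p q q' : ℕ)
    (hpq : p + q ≤ m) (hq' : q' ≤ q) (ω : Fin p → ℝ) (hω : ∀ j, 0 < ω j) :
    (∀ ε : ℝ, ε ≠ 0 →
        (scaleT m p q q' ε)ᵀ * sympJ m * scaleT m p q q' ε = sympJ m) ∧
    Filter.Tendsto
      (fun ε : ℝ => (scaleT m p q q' ε)ᵀ * NMat m p q ω * scaleT m p q q' ε)
      (nhdsWithin 0 {(0 : ℝ)}ᶜ) (nhds (NMat m p q' ω)) ∧
    NMat m p q' ω ∈ closure (sympOrbit m (NMat m p q ω)) := by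
  have hlim : Filter.Tendsto
      (fun ε : ℝ => (scaleT m p q q' ε)ᵀ * NMat m p q ω * scaleT m p q q' ε)
      (nhdsWithin 0 {(0 : ℝ)}ᶜ) (nhds (NMat m p q' ω)) := by
    simp only [scaleT_congr_NMat m p hq' ω]
    have hcont : Continuous fun ε : ℝ =>
        NMat m p q' ω + ε ^ 2 • (NMat m p q ω - NMat m p q' ω) := by fun_prop
    simpa using (hcont.tendsto 0).mono_left nhdsWithin_le_nhds
  refine ⟨fun ε hε => scaleT_symplectic m p q q' hε, hlim, mem_closure_of_tendsto hlim ?_⟩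
  filter_upwards [self_mem_nhdsWithin] with ε hε
  exact ⟨scaleT m p q q' ε, scaleT_symplectic m p q q' hε, rfl⟩
end
end

section
/- Let p, q ≥ 0 be integers with p + q ≤ m and let ω₁, …, ω_p > 0. Then the Sp(2m,ℝ)-congruence orbit of N(p,q,ω) is a closed subset of the space of real 2m×2m matrices if and only if q = 0. -/
open Matrix

noncomputable section

theorem symplectic_iff_mem {m : ℕ} (T : Matrix (Fin m ⊕ Fin m) (Fin m ⊕ Fin m) ℝ) :
    Tᵀ * sympJ m * T = sympJ m ↔ T ∈ symplecticGroup (Fin m) ℝ := by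
  have hJ : sympJ m = -Matrix.J (Fin m) ℝ := by
    simp [sympJ, Matrix.J, Matrix.fromBlocks_neg]
  rw [SymplecticGroup.mem_iff', hJ]
  simp

theorem symplectic_iff_transpose {m : ℕ} (T : Matrix (Fin m ⊕ Fin m) (Fin m ⊕ Fin m) ℝ) :
    Tᵀ * sympJ m * T = sympJ m ↔ T * sympJ m * Tᵀ = sympJ m := by
  rw [symplectic_iff_mem, ← SymplecticGroup.transpose_mem_iff, ← symplectic_iff_mem,
    Matrix.transpose_transpose]

/-- The standard symplectic form on `ℝ^(2m)`. -/
def sympForm {m : ℕ} (x y : Fin m ⊕ Fin m → ℝ) : ℝ := x ⬝ᵥ (sympJ m *ᵥ y)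

theorem sympForm_swap {m : ℕ} (x y : Fin m ⊕ Fin m → ℝ) : sympForm x y = -sympForm y x := by
  unfold sympForm
  rw [Matrix.dotProduct_mulVec, ← Matrix.mulVec_transpose, sympJ_transpose, Matrix.neg_mulVec,
    neg_dotProduct, dotProduct_comm]

theorem sympForm_self {m : ℕ} (x : Fin m ⊕ Fin m → ℝ) : sympForm x x = 0 := by
  linarith [sympForm_swap x x]

theorem mul_sympJ_mul_transpose_apply {m : ℕ} (T : Matrix (Fin m ⊕ Fin m) (Fin m ⊕ Fin m) ℝ)
    (i j : Fin m ⊕ Fin m) : (T * sympJ m * Tᵀ) i j = sympForm (T i) (T j) := by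
  rw [Matrix.mul_assoc, Matrix.mul_apply']
  rfl

/-- The position of a coordinate inside its block. -/
def blockIdx {m : ℕ} : Fin m ⊕ Fin m → ℕ := Sum.elim Fin.val Fin.val

/-- The rows of `T` at positions `< n` form a symplectic family. -/
def PartialSymplectic {m : ℕ} (n : ℕ) (T : Matrix (Fin m ⊕ Fin m) (Fin m ⊕ Fin m) ℝ) : Prop :=
  ∀ i j, blockIdx i < n → blockIdx j < n → sympForm (T i) (T j) = sympJ m i j

theorem exists_ne_zero_sympForm_eq_zero {m n : ℕ} (hn : n < m)
    (T : Matrix (Fin m ⊕ Fin m) (Fin m ⊕ Fin m) ℝ) :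
    ∃ u : Fin m ⊕ Fin m → ℝ, u ≠ 0 ∧ ∀ i, blockIdx i < n → sympForm (T i) u = 0 := by
  let L : (Fin m ⊕ Fin m → ℝ) →ₗ[ℝ] ({i : Fin m ⊕ Fin m // blockIdx i < n} → ℝ) :=
    LinearMap.funLeft ℝ ℝ Subtype.val ∘ₗ (T * sympJ m).mulVecLin
  have hcard : Fintype.card {i : Fin m ⊕ Fin m // blockIdx i < n} < Fintype.card (Fin m ⊕ Fin m) :=
    Fintype.card_subtype_lt (x := Sum.inl ⟨n, hn⟩) (by simp [blockIdx])
  have hker : LinearMap.ker L ≠ ⊥ := LinearMap.ker_ne_bot_of_finrank_lt (by simpa using hcard)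
  obtain ⟨u, hu, hu0⟩ := Submodule.exists_mem_ne_zero_of_ne_bot hker
  refine ⟨u, hu0, fun i hi => ?_⟩
  have h := congrFun (LinearMap.mem_ker.1 hu) ⟨i, hi⟩
  simp only [L, LinearMap.comp_apply, LinearMap.funLeft_apply, Matrix.mulVecLin_apply,
    ← Matrix.mulVec_mulVec] at h
  exact h

theorem exists_sympForm_eq_one {m : ℕ} {u : Fin m ⊕ Fin m → ℝ} (hu : u ≠ 0) :
    ∃ w, sympForm u w = 1 := by
  refine ⟨-(u ⬝ᵥ u)⁻¹ • (sympJ m *ᵥ u), ?_⟩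
  have h : u ⬝ᵥ u ≠ 0 := fun h => hu (dotProduct_self_eq_zero.1 h)
  rw [sympForm, Matrix.mulVec_smul, Matrix.mulVec_mulVec, sympJ_mul_self, Matrix.neg_mulVec,
    Matrix.one_mulVec, dotProduct_smul, dotProduct_neg, smul_eq_mul, neg_mul_neg,
    inv_mul_cancel₀ h]

theorem sympJ_mulVec_eq_zero {m n : ℕ} {b : Fin m ⊕ Fin m → ℝ}
    (hb : ∀ k, ¬ blockIdx k < n → b k = 0) (k : Fin m ⊕ Fin m) (hk : ¬ blockIdx k < n) :
    (sympJ m *ᵥ b) k = 0 := by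
  rw [sympJ, Matrix.fromBlocks_mulVec]
  rcases k with k | k
  · simpa using hb (Sum.inr k) hk
  · simpa [Matrix.neg_mulVec] using hb (Sum.inl k) hk

/-- A vector can be made symplectically orthogonal to a symplectic family by adding a combination
of its members. -/
theorem PartialSymplectic.exists_orthogonal {m n : ℕ}
    {T : Matrix (Fin m ⊕ Fin m) (Fin m ⊕ Fin m) ℝ} (hT : PartialSymplectic n T)
    {u : Fin m ⊕ Fin m → ℝ} (hu : ∀ i, blockIdx i < n → sympForm (T i) u = 0)
    (w : Fin m ⊕ Fin m → ℝ) :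
    ∃ v, sympForm u v = sympForm u w ∧ ∀ i, blockIdx i < n → sympForm (T i) v = 0 := by
  let b : Fin m ⊕ Fin m → ℝ := fun j => if blockIdx j < n then sympForm (T j) w else 0
  let c := sympJ m *ᵥ b
  have hc : ∀ k, ¬ blockIdx k < n → c k = 0 :=
    sympJ_mulVec_eq_zero fun k hk => if_neg hk
  have key : ∀ x, sympForm x (w + Tᵀ *ᵥ c) = sympForm x w + ∑ k, sympForm x (T k) * c k := by
    intro x
    have : sympForm x (Tᵀ *ᵥ c) = ∑ k, sympForm x (T k) * c k := by
      unfold sympForm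
      rw [Matrix.mulVec_mulVec, Matrix.dotProduct_mulVec]
      refine Finset.sum_congr rfl fun k _ => ?_
      congr 1
    rw [← this]
    simp [sympForm, Matrix.mulVec_add]
  refine ⟨w + Tᵀ *ᵥ c, ?_, fun i hi => ?_⟩
  · rw [key, Finset.sum_eq_zero, add_zero]
    intro k _
    by_cases hk : blockIdx k < n
    · rw [sympForm_swap, hu k hk]; simp
    · rw [hc k hk, mul_zero]
  · have h : ∑ k, sympForm (T i) (T k) * c k = (sympJ m *ᵥ c) i := by
      refine Finset.sum_congr rfl fun k _ => ?_
      by_cases hk : blockIdx k < n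
      · rw [hT i k hi hk]
      · rw [hc k hk, mul_zero, mul_zero]
    rw [key, h]
    simp [c, b, Matrix.mulVec_mulVec, sympJ_mul_self, Matrix.neg_mulVec, hi]

theorem PartialSymplectic.exists_succ {m n : ℕ} (hn : n < m)
    {T : Matrix (Fin m ⊕ Fin m) (Fin m ⊕ Fin m) ℝ} (hT : PartialSymplectic n T) :
    ∃ T' : Matrix (Fin m ⊕ Fin m) (Fin m ⊕ Fin m) ℝ,
      PartialSymplectic (n + 1) T' ∧ ∀ i, blockIdx i < n → T' i = T i := by
  obtain ⟨u, hu0, hu⟩ := exists_ne_zero_sympForm_eq_zero hn T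
  obtain ⟨w, hw⟩ := exists_sympForm_eq_one hu0
  obtain ⟨v, huv, hv⟩ := hT.exists_orthogonal hu w
  rw [hw] at huv
  have hvu : sympForm v u = -1 := by rw [sympForm_swap, huv]
  have hu' : ∀ i, blockIdx i < n → sympForm u (T i) = 0 := fun i hi => by
    rw [sympForm_swap, hu i hi, neg_zero]
  have hv' : ∀ i, blockIdx i < n → sympForm v (T i) = 0 := fun i hi => by
    rw [sympForm_swap, hv i hi, neg_zero]
  let T' : Matrix (Fin m ⊕ Fin m) (Fin m ⊕ Fin m) ℝ := fun i =>
    if blockIdx i < n then T i else Sum.elim (fun _ => u) (fun _ => v) i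
  have hlt : ∀ i, blockIdx i < n → T' i = T i := fun i hi => if_pos hi
  have hinl : ∀ h : n < m, T' (Sum.inl ⟨n, h⟩) = u := fun h => if_neg (by simp [blockIdx])
  have hinr : ∀ h : n < m, T' (Sum.inr ⟨n, h⟩) = v := fun h => if_neg (by simp [blockIdx])
  have hcases : ∀ i : Fin m ⊕ Fin m, blockIdx i < n + 1 →
      blockIdx i < n ∨ i = Sum.inl ⟨n, hn⟩ ∨ i = Sum.inr ⟨n, hn⟩ := by
    rintro (i | i) hi <;> simp only [blockIdx, Sum.elim_inl, Sum.elim_inr] at hi ⊢ <;>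
      simp [Fin.ext_iff] <;> omega
  refine ⟨T', fun i j hi hj => ?_, hlt⟩
  have hJl : ∀ i : Fin m ⊕ Fin m, blockIdx i < n → sympJ m i (Sum.inl ⟨n, hn⟩) = 0 ∧
      sympJ m i (Sum.inr ⟨n, hn⟩) = 0 ∧ sympJ m (Sum.inl ⟨n, hn⟩) i = 0 ∧
      sympJ m (Sum.inr ⟨n, hn⟩) i = 0 := by
    rintro (i | i) hi <;> simp only [blockIdx, Sum.elim_inl, Sum.elim_inr] at hi <;>
      simp [sympJ, Fin.ext_iff, hi.ne, hi.ne']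
  rcases hcases i hi with hi | rfl | rfl <;> rcases hcases j hj with hj | rfl | rfl
  · rw [hlt i hi, hlt j hj, hT i j hi hj]
  all_goals
    simp only [hlt, hinl, hinr, hu, hv, hu', hv', hJl, hi, hj, sympForm_self, huv, hvu] <;>
    simp [sympJ]

/-- A symplectic family of rows extends to a symplectic matrix. -/
theorem PartialSymplectic.exists_extension {m n : ℕ} (hn : n ≤ m)
    {T : Matrix (Fin m ⊕ Fin m) (Fin m ⊕ Fin m) ℝ} (hT : PartialSymplectic n T) :
    ∃ T' : Matrix (Fin m ⊕ Fin m) (Fin m ⊕ Fin m) ℝ,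
      T'ᵀ * sympJ m * T' = sympJ m ∧ ∀ i, blockIdx i < n → T' i = T i := by
  induction hn using Nat.decreasingInduction generalizing T with
  | self =>
    refine ⟨T, (symplectic_iff_transpose T).2 ?_, fun _ _ => rfl⟩
    ext i j
    rw [mul_sympJ_mul_transpose_apply]
    have h : ∀ i : Fin m ⊕ Fin m, blockIdx i < m := by rintro (i | i) <;> exact i.2
    exact hT i j (h i) (h j)
  | of_succ n hn ih =>
    obtain ⟨S, hS, hST⟩ := hT.exists_succ hn
    obtain ⟨T', hT', hTS⟩ := ih hS
    exact ⟨T', hT', fun i hi => (hTS i (by omega)).trans (hST i hi)⟩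

theorem transpose_mul_diagonal_mul_apply {n : Type*} [Fintype n] [DecidableEq n]
    (S : Matrix n n ℝ) (d : n → ℝ) (j k : n) :
    (Sᵀ * Matrix.diagonal d * S) j k = ∑ i, d i * (S i j * S i k) := by
  rw [Matrix.mul_apply]
  simp only [Matrix.mul_diagonal, Matrix.transpose_apply]
  exact Finset.sum_congr rfl fun i _ => by ring

/-- Matrices whose rows at positions `< n` form a symplectic family, the other rows being zero. -/
def truncatedSymplectic (m n : ℕ) : Set (Matrix (Fin m ⊕ Fin m) (Fin m ⊕ Fin m) ℝ) :=
  {S | PartialSymplectic n S ∧ ∀ i j, ¬ blockIdx i < n → S i j = 0}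

theorem isClosed_truncatedSymplectic (m n : ℕ) : IsClosed (truncatedSymplectic m n) := by
  have h : truncatedSymplectic m n =
      (⋂ i, ⋂ j, ⋂ _ : blockIdx i < n, ⋂ _ : blockIdx j < n,
        {S | (S * sympJ m * Sᵀ) i j = sympJ m i j}) ∩
      ⋂ i, ⋂ j, ⋂ _ : ¬ blockIdx i < n, {S | S i j = 0} := by
    ext S
    simp [truncatedSymplectic, PartialSymplectic, mul_sympJ_mul_transpose_apply]
  rw [h]
  refine IsClosed.inter ?_ ?_
  · refine isClosed_iInter fun i => isClosed_iInter fun j => isClosed_iInter fun _ =>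
      isClosed_iInter fun _ => isClosed_eq ?_ continuous_const
    exact Continuous.matrix_elem (by fun_prop) i j
  · exact isClosed_iInter fun i => isClosed_iInter fun j => isClosed_iInter fun _ =>
      isClosed_eq (continuous_id.matrix_elem i j) continuous_const

theorem sympOrbit_diagonal_eq_image {m p : ℕ} (hp : p ≤ m) {d : Fin m ⊕ Fin m → ℝ}
    (hd : ∀ i, ¬ blockIdx i < p → d i = 0) :
    sympOrbit m (Matrix.diagonal d) =
      (fun S => Sᵀ * Matrix.diagonal d * S) '' truncatedSymplectic m p := by
  have hcongr : ∀ S T : Matrix (Fin m ⊕ Fin m) (Fin m ⊕ Fin m) ℝ,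
      (∀ i, blockIdx i < p → S i = T i) →
      Sᵀ * Matrix.diagonal d * S = Tᵀ * Matrix.diagonal d * T := by
    intro S T h
    ext j k
    rw [transpose_mul_diagonal_mul_apply, transpose_mul_diagonal_mul_apply]
    refine Finset.sum_congr rfl fun i _ => ?_
    by_cases hi : blockIdx i < p
    · rw [h i hi]
    · rw [hd i hi, zero_mul, zero_mul]
  ext A
  constructor
  · rintro ⟨T, hT, rfl⟩
    rw [symplectic_iff_transpose] at hT
    let S : Matrix (Fin m ⊕ Fin m) (Fin m ⊕ Fin m) ℝ :=
      fun i => if blockIdx i < p then T i else 0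
    have hS : ∀ i, blockIdx i < p → S i = T i := fun i hi => if_pos hi
    refine ⟨S, ⟨fun i j hi hj => ?_, fun i j hi => ?_⟩, hcongr S T hS⟩
    · rw [hS i hi, hS j hj, ← mul_sympJ_mul_transpose_apply, hT]
    · exact congrFun (if_neg hi : S i = 0) j
  · rintro ⟨S, hS, rfl⟩
    obtain ⟨T, hT, hTS⟩ := hS.1.exists_extension hp
    exact ⟨T, hT, (hcongr T S hTS).symm⟩

theorem isClosed_sympOrbit_diagonal {m p : ℕ} (hp : p ≤ m) {d : Fin m ⊕ Fin m → ℝ}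
    (hpos : ∀ i, blockIdx i < p → 0 < d i) (hd : ∀ i, ¬ blockIdx i < p → d i = 0) :
    IsClosed (sympOrbit m (Matrix.diagonal d)) := by
  rw [sympOrbit_diagonal_eq_image hp hd]
  let F : Matrix (Fin m ⊕ Fin m) (Fin m ⊕ Fin m) ℝ → Matrix (Fin m ⊕ Fin m) (Fin m ⊕ Fin m) ℝ :=
    fun S => Sᵀ * Matrix.diagonal d * S
  have hFc : Continuous F := by fun_prop
  have hd0 : ∀ i, 0 ≤ d i := fun i => by
    by_cases hi : blockIdx i < p
    · exact (hpos i hi).le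
    · exact (hd i hi).ge
  refine isClosed_of_closure_subset fun A hA => ?_
  let U : Set (Matrix (Fin m ⊕ Fin m) (Fin m ⊕ Fin m) ℝ) := ⋂ j, {B | B j j < A j j + 1}
  have hU : IsOpen U := isOpen_iInter_of_finite fun j =>
    isOpen_lt (continuous_id.matrix_elem j j) continuous_const
  have hAU : A ∈ U := Set.mem_iInter.2 fun j => lt_add_one (A j j)
  let R : Fin m ⊕ Fin m → Fin m ⊕ Fin m → ℝ := fun i j => √((d i)⁻¹ * (A j j + 1))
  let K : Set (Matrix (Fin m ⊕ Fin m) (Fin m ⊕ Fin m) ℝ) :=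
    (Set.univ.pi fun i => Set.univ.pi fun j => Set.Icc (-R i j) (R i j)) ∩ truncatedSymplectic m p
  have hK : IsCompact K :=
    (isCompact_univ_pi fun i => isCompact_univ_pi fun j => isCompact_Icc).inter_right
      (isClosed_truncatedSymplectic m p)
  have hsub : U ∩ F '' truncatedSymplectic m p ⊆ F '' K := by
    rintro _ ⟨hBU, S, hS, rfl⟩
    refine ⟨S, ⟨fun i _ j _ => ?_, hS⟩, rfl⟩
    refine abs_le.1 (Real.abs_le_sqrt ?_)
    by_cases hi : blockIdx i < p
    · have hj : F S j j < A j j + 1 := Set.mem_iInter.1 hBU j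
      have hle : d i * (S i j * S i j) ≤ F S j j := by
        refine le_of_le_of_eq ?_ (transpose_mul_diagonal_mul_apply S d j j).symm
        exact Finset.single_le_sum
          (fun k _ => mul_nonneg (hd0 k) (mul_self_nonneg (S k j))) (Finset.mem_univ i)
      rw [inv_mul_eq_div, le_div_iff₀ (hpos i hi)]
      nlinarith
    · simp [hS.2 i j hi, hd i hi]
  have hA' : A ∈ closure (F '' K) := closure_mono hsub (hU.inter_closure ⟨hAU, hA⟩)
  rw [(hK.image hFc).isClosed.closure_eq] at hA'
  exact Set.image_mono Set.inter_subset_right hA'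

theorem rank_eq_of_mem_sympOrbit {m : ℕ} {A G : Matrix (Fin m ⊕ Fin m) (Fin m ⊕ Fin m) ℝ}
    (h : A ∈ sympOrbit m G) : A.rank = G.rank := by
  obtain ⟨T, hT, rfl⟩ := h
  have hdet : IsUnit T.det := SymplecticGroup.symplectic_det ((symplectic_iff_mem T).1 hT)
  rw [Matrix.rank_mul_eq_left_of_isUnit_det _ _ hdet,
    Matrix.rank_mul_eq_right_of_isUnit_det _ _ (by rwa [Matrix.det_transpose])]

/-- Squeezing the conjugate pairs at positions `p ≤ j < p + q` multiplies the degenerate part of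
the normal form by `t ^ 2`. -/
theorem NMat_add_smul_mem_sympOrbit (m p q : ℕ) (ω : Fin p → ℝ) {t : ℝ} (ht : t ≠ 0) :
    NMat m p 0 ω + t ^ 2 • (NMat m p q ω - NMat m p 0 ω) ∈ sympOrbit m (NMat m p q ω) := by
  let a : Fin m → ℝ := fun j => if (j : ℕ) < p then 1 else t
  have ha : ∀ j, a j ≠ 0 := fun j => by simp only [a]; split_ifs <;> simp [ht]
  refine ⟨Matrix.diagonal (Sum.elim (fun j => (a j)⁻¹) a), ?_, ?_⟩
  · rw [← Matrix.fromBlocks_diagonal, sympJ, Matrix.fromBlocks_transpose,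
      Matrix.fromBlocks_multiply, Matrix.fromBlocks_multiply]
    simp [ha, ← Matrix.diagonal_one]
  · simp only [NMat, Matrix.diagonal_transpose, Matrix.diagonal_mul_diagonal,
      Matrix.diagonal_sub, Matrix.diagonal_add, ← Matrix.diagonal_smul]
    congr 1
    ext (j | j) <;> by_cases hj : (j : ℕ) < p <;> simp [a, hj]
    split_ifs <;> ring

theorem NMat_zero_mem_closure (m p q : ℕ) (ω : Fin p → ℝ) :
    NMat m p 0 ω ∈ closure (sympOrbit m (NMat m p q ω)) := by
  have hc : Continuous fun t : ℝ => NMat m p 0 ω + t ^ 2 • (NMat m p q ω - NMat m p 0 ω) := by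
    fun_prop
  have hlim := (hc.tendsto 0).mono_left (nhdsWithin_le_nhds (s := {0}ᶜ))
  simp only [ne_eq, OfNat.ofNat_ne_zero, not_false_eq_true, zero_pow, zero_smul, add_zero] at hlim
  exact mem_closure_of_tendsto hlim
    (eventually_mem_nhdsWithin.mono fun t ht => NMat_add_smul_mem_sympOrbit m p q ω ht)

theorem rank_NMat_zero_lt {m p q : ℕ} (hpq : p + q ≤ m) (hq : q ≠ 0) (ω : Fin p → ℝ) :
    (NMat m p 0 ω).rank < (NMat m p q ω).rank := by
  classical
  rw [NMat, NMat, Matrix.rank_diagonal, Matrix.rank_diagonal, Fintype.card_subtype,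
    Fintype.card_subtype]
  refine Finset.card_lt_card ((Finset.ssubset_iff_of_subset fun i => ?_).2
    ⟨Sum.inr ⟨p, by omega⟩, ?_⟩)
  · rcases i with j | j <;> by_cases hj : (j : ℕ) < p <;> simp [hj]
  · simp [Nat.pos_of_ne_zero hq]

/-- The symplectic congruence orbit of `N(p,q,ω)` is closed iff `q = 0`. -/
theorem sympOrbit_normal_form_isClosed_iff (m p q : ℕ) (hpq : p + q ≤ m)
    (ω : Fin p → ℝ) (hω : ∀ j, 0 < ω j) :
    IsClosed (sympOrbit m (NMat m p q ω)) ↔ q = 0 := by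
  constructor
  · intro h
    by_contra hq
    have hmem := NMat_zero_mem_closure m p q ω
    rw [h.closure_eq] at hmem
    exact (rank_NMat_zero_lt hpq hq ω).ne (rank_eq_of_mem_sympOrbit hmem)
  · rintro rfl
    refine isClosed_sympOrbit_diagonal (p := p) hpq ?_ ?_
    · rintro (j | j) hj <;> simp only [blockIdx, Sum.elim_inl, Sum.elim_inr] at hj <;>
        simpa [hj] using pow_pos (hω ⟨j, hj⟩) 2
    · rintro (j | j) hj <;> simp only [blockIdx, Sum.elim_inl, Sum.elim_inr] at hj <;> simp [hj]
end
end

section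
/- Let Z be a real 3×(2m) matrix with rank(Z) ≥ 2 and J the 2m×2m standard symplectic matrix. Then the linear map from real 3×(2m) matrices to antisymmetric 3×3 matrices given by W ↦ W·J·Zᵀ + Z·J·Wᵀ is surjective. (This map is the differential at Z of the angular momentum map L(Z) = Z·J·Zᵀ, so every nonzero value of angular momentum in three dimensions is a regular value of L on the set of matrices of rank at least 2.) -/
open Matrix

noncomputable section

/-- Every linear map between vector spaces has a generalized inverse. -/
theorem exists_generalized_inverse {K V V' : Type*} [Field K] [AddCommGroup V] [Module K V]
    [AddCommGroup V'] [Module K V'] (f : V →ₗ[K] V') :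
    ∃ g : V' →ₗ[K] V, ∀ v, f (g (f v)) = f v := by
  obtain ⟨s, hs⟩ := f.rangeRestrict.exists_rightInverse_of_surjective f.range_rangeRestrict
  obtain ⟨g, hg⟩ := LinearMap.exists_extend s
  refine ⟨g, fun v => ?_⟩
  have h₁ : g (f v) = s (f.rangeRestrict v) := LinearMap.congr_fun hg (f.rangeRestrict v)
  have h₂ := congrArg Subtype.val (LinearMap.congr_fun hs (f.rangeRestrict v))
  rw [h₁]
  exact h₂

/-- An antisymmetric real matrix has zero quadratic form. -/
theorem dotProduct_mulVec_self_of_transpose_eq_neg {n : Type*} [Fintype n] {A : Matrix n n ℝ}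
    (hA : Aᵀ = -A) (x : n → ℝ) : x ⬝ᵥ A *ᵥ x = 0 := by
  have h : x ⬝ᵥ A *ᵥ x = -(x ⬝ᵥ A *ᵥ x) := by
    conv_lhs => rw [dotProduct_mulVec, ← mulVec_transpose, hA, neg_mulVec, neg_dotProduct,
      dotProduct_comm]
  linarith

/-- A matrix whose kernel is at most a line has a left inverse up to a matrix whose congruence
annihilates antisymmetric matrices. -/
theorem exists_congruence_one_sub_mul_eq_zero {k n : Type*} [Fintype k] [DecidableEq k]
    [Fintype n] [DecidableEq n] (B : Matrix k n ℝ) (hB : Fintype.card n ≤ B.rank + 1) :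
    ∃ Y : Matrix n k ℝ, ∀ A : Matrix n n ℝ, Aᵀ = -A →
      (1 - Y * B)ᵀ * A * (1 - Y * B) = 0 := by
  have hker : Module.finrank ℝ (LinearMap.ker B.mulVecLin) ≤ 1 := by
    have h := B.mulVecLin.finrank_range_add_finrank_ker
    rw [Module.finrank_fintype_fun_eq_card] at h
    rw [Matrix.rank] at hB
    omega
  obtain ⟨x, hx⟩ := finrank_le_one_iff.mp hker
  obtain ⟨g, hg⟩ := exists_generalized_inverse B.mulVecLin
  refine ⟨LinearMap.toMatrix' g, fun A hA => ?_⟩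
  have hQ (w : n → ℝ) : ∃ c : ℝ, (1 - LinearMap.toMatrix' g * B) *ᵥ w = c • (x : n → ℝ) := by
    have hw : (1 - LinearMap.toMatrix' g * B) *ᵥ w = w - g (B *ᵥ w) := by
      rw [sub_mulVec, one_mulVec, ← mulVec_mulVec, LinearMap.toMatrix'_mulVec]
    have hmem : w - g (B *ᵥ w) ∈ LinearMap.ker B.mulVecLin := by
      rw [LinearMap.mem_ker, map_sub, sub_eq_zero]
      exact (hg w).symm
    obtain ⟨c, hc⟩ := hx ⟨_, hmem⟩
    exact ⟨c, hw.trans (congrArg Subtype.val hc).symm⟩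
  set Q := 1 - LinearMap.toMatrix' g * B
  ext i j
  obtain ⟨c, hc⟩ := hQ (Pi.single i 1)
  obtain ⟨d, hd⟩ := hQ (Pi.single j 1)
  have hentry : (Qᵀ * A * Q) i j = (Q *ᵥ Pi.single i 1) ⬝ᵥ A *ᵥ (Q *ᵥ Pi.single j 1) := by
    rw [Matrix.mul_assoc, Matrix.mul_apply_eq_vecMul, mulVec_single_one, mulVec_single_one]
    rfl
  rw [hentry, hc, hd, mulVec_smul, smul_dotProduct, dotProduct_smul,
    dotProduct_mulVec_self_of_transpose_eq_neg hA]
  simp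

/-- At a matrix `Z` of rank at least `2`, the differential of the angular momentum
map, `W ↦ W·J·Zᵀ + Z·J·Wᵀ`, is surjective onto antisymmetric `3×3` matrices. -/
theorem angular_momentum_differential_surjective (m : ℕ)
    (Z : Matrix (Fin 3) (Fin m ⊕ Fin m) ℝ) (hZ : 2 ≤ Z.rank) :
    ∀ A : Matrix (Fin 3) (Fin 3) ℝ, Aᵀ = -A →
      ∃ W : Matrix (Fin 3) (Fin m ⊕ Fin m) ℝ,
        W * sympJ m * Zᵀ + Z * sympJ m * Wᵀ = A := by
  intro A hA
  obtain ⟨Y, hY⟩ := exists_congruence_one_sub_mul_eq_zero Zᵀ (by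
    rw [rank_transpose, Fintype.card_fin]; omega)
  set P := Y * Zᵀ with hP
  set U := (A - (1 / 2 : ℝ) • (Pᵀ * A)) * Y
  have hUZ : U * Zᵀ = A * P - (1 / 2 : ℝ) • (Pᵀ * A * P) := by
    rw [Matrix.mul_assoc, ← hP, Matrix.sub_mul, Matrix.smul_mul]
  have hZU : Z * Uᵀ = (1 / 2 : ℝ) • (Pᵀ * A * P) - Pᵀ * A := by
    rw [← transpose_transpose Z, ← transpose_mul, hUZ]
    simp only [transpose_sub, transpose_smul, transpose_mul, transpose_transpose, hA,
      Matrix.mul_neg, Matrix.neg_mul, Matrix.mul_assoc, smul_neg]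
    abel
  refine ⟨-(U * sympJ m), ?_⟩
  have hW : -(U * sympJ m) * sympJ m * Zᵀ = U * Zᵀ := by
    rw [Matrix.neg_mul, Matrix.mul_assoc U, sympJ_mul_self]
    simp
  have hWt : Z * sympJ m * (-(U * sympJ m))ᵀ = -(Z * Uᵀ) := by
    rw [transpose_neg, transpose_mul, sympJ_transpose, Matrix.neg_mul, neg_neg,
      Matrix.mul_assoc, ← Matrix.mul_assoc (sympJ m), sympJ_mul_self]
    simp
  have hcongr := hY A hA
  rw [transpose_sub, transpose_one, Matrix.sub_mul, Matrix.one_mul, Matrix.mul_sub,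
    Matrix.mul_one, Matrix.sub_mul] at hcongr
  rw [hW, hWt, hUZ, hZU, ← sub_eq_zero, ← neg_eq_zero, ← hcongr]
  module
end
end
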